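/- Let F : ℂ² → ℂ² be a polynomial map with nonzero constant Jacobian determinant. If F is injective, then F is bijective and its inverse is also a polynomial map. -/

import Mathlib

open MvPolynomial

def IsPolyMap (F : ℂ × ℂ → ℂ × ℂ) : Prop :=
  ∃ P Q : MvPolynomial (Fin 2) ℂ,
    ∀ p : ℂ × ℂ, F p = (eval ![p.1, p.2] P, eval ![p.1, p.2] Q)

noncomputable def jacDet (P Q : MvPolynomial (Fin 2) ℂ) : MvPolynomial (Fin 2) ℂ :=
  pderiv 0 P * pderiv 1 Q - pderiv 1 P * pderiv 0 Q

open scoped TensorProduct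

/-- **Nullstellensatz**: a function vanishing at all `k`-points is nilpotent. -/
theorem isNilpotent_of_forall_algHom_apply_eq_zero {k R : Type*} [Field k] [IsAlgClosed k]
    [CommRing R] [Algebra k R] [Algebra.FiniteType k R] {z : R}
    (hz : ∀ φ : R →ₐ[k] k, φ z = 0) : IsNilpotent z := by
  have : IsJacobsonRing R := isJacobsonRing_of_finiteType (A := k)
  rw [← mem_nilradical, nilradical, Ideal.zero_eq_bot,
    ← IsJacobsonRing.out ‹_› (Ideal.radical_isRadical (⊥ : Ideal R)), Ideal.jacobson,
    Submodule.mem_sInf]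
  rintro M ⟨-, hM⟩
  let := Ideal.Quotient.field M
  have : Module.Finite k (R ⧸ M) := finite_of_finite_type_of_isJacobsonRing k (R ⧸ M)
  let e : k ≃ₐ[k] R ⧸ M := AlgEquiv.ofBijective (Algebra.ofId k (R ⧸ M))
    IsAlgClosed.algebraMap_bijective_of_isIntegral
  rw [← Ideal.Quotient.eq_zero_iff_mem]
  simpa using hz (e.symm.toAlgHom.comp (Ideal.Quotient.mkₐ k M))

/-- An element of a separable extension fixed by all embeddings into an algebraically closed field
lies in the base field. -/
theorem mem_range_algebraMap_of_forall_algHom_eq {K L : Type*} (Ω : Type*) [Field K] [Field L]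
    [Field Ω] [Algebra K L] [Algebra K Ω] [Algebra.IsSeparable K L] [IsAlgClosed Ω] {x : L}
    (hx : ∀ σ τ : L →ₐ[K] Ω, σ x = τ x) : x ∈ (algebraMap K L).range := by
  apply minpoly.mem_range_of_degree_eq_one
  have hsep := Algebra.IsSeparable.isSeparable K x
  have hint := Algebra.IsIntegral.isIntegral (R := K) x
  rw [Polynomial.degree_eq_natDegree (minpoly.ne_zero hint),
    ← Polynomial.card_rootSet_eq_natDegree (K := Ω) hsep (IsAlgClosed.splits _)]
  have hsub : Subsingleton ((minpoly K x).rootSet Ω) := by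
    rw [Set.subsingleton_coe, ← Algebra.IsAlgebraic.range_eval_eq_rootSet_minpoly Ω x]
    rintro _ ⟨σ, rfl⟩ _ ⟨τ, rfl⟩
    exact hx σ τ
  have hle := Fintype.card_le_one_iff_subsingleton.mpr hsub
  have hpos := minpoly.natDegree_pos hint
  rw [← Polynomial.card_rootSet_eq_natDegree (K := Ω) hsep (IsAlgClosed.splits _)] at hpos
  exact_mod_cast le_antisymm hle hpos

section

variable {k A B : Type*} [Field k] [IsAlgClosed k] [CommRing A] [CommRing B] [Algebra k A]
  [Algebra k B] [Algebra A B] [IsScalarTower k A B]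

/-- If `Spec B → Spec A` is injective on `k`-points, then any two `A`-algebra homomorphisms from
`B` to a reduced ring coincide. -/
theorem algHom_eq_of_injective_comp [Algebra.FiniteType k B]
    (hinj : Function.Injective fun φ : B →ₐ[k] k ↦ φ.comp (IsScalarTower.toAlgHom k A B))
    {Ω : Type*} [CommRing Ω] [IsReduced Ω] [Algebra A Ω] (σ τ : B →ₐ[A] Ω) : σ = τ := by
  ext x
  have : Algebra.FiniteType A B := .of_restrictScalars_finiteType k A B
  have : Algebra.FiniteType k (B ⊗[A] B) := .trans (S := B) inferInstance inferInstance
  have hz : IsNilpotent (x ⊗ₜ[A] (1 : B) - 1 ⊗ₜ x) := by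
    refine isNilpotent_of_forall_algHom_apply_eq_zero (k := k) fun φ ↦ ?_
    have h := hinj (a₁ := φ.comp
        ((Algebra.TensorProduct.includeLeft : B →ₐ[A] B ⊗[A] B).restrictScalars k))
      (a₂ := φ.comp ((Algebra.TensorProduct.includeRight : B →ₐ[A] B ⊗[A] B).restrictScalars k))
      (by ext a; simp)
    simpa [sub_eq_zero] using DFunLike.congr_fun h x
  simpa [sub_eq_zero] using (hz.map (Algebra.TensorProduct.lift σ τ fun _ _ ↦ .all _ _)).eq_zero

/-- A generically finite dominant morphism of affine varieties in characteristic zero which is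
injective on `k`-points is birational: each function on the source is a reduced fraction of
functions on the target. -/
theorem exists_isRelPrime_of_injective_comp [CharZero k] [IsDomain A] [IsDomain B]
    [UniqueFactorizationMonoid A] [FaithfulSMul A B] [Algebra.IsAlgebraic A B]
    [Algebra.FiniteType k B]
    (hinj : Function.Injective fun φ : B →ₐ[k] k ↦ φ.comp (IsScalarTower.toAlgHom k A B))
    (x : B) : ∃ a b : A, a ≠ 0 ∧ IsRelPrime b a ∧ algebraMap A B b = algebraMap A B a * x := by
  let : Algebra (FractionRing A) (FractionRing B) := FractionRing.liftAlgebra A (FractionRing B)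
  have : IsScalarTower A (FractionRing A) (FractionRing B) :=
    FractionRing.isScalarTower_liftAlgebra _ _
  have : Algebra.IsAlgebraic B (FractionRing B) := IsLocalization.isAlgebraic _ (nonZeroDivisors B)
  have : Algebra.IsAlgebraic A (FractionRing B) := .trans A B (FractionRing B)
  have : Algebra.IsAlgebraic (FractionRing A) (FractionRing B) :=
    .extendScalars (IsFractionRing.injective A _)
  have : CharZero (FractionRing A) :=
    charZero_of_injective_algebraMap (algebraMap k (FractionRing A)).injective
  obtain ⟨y, hy⟩ := mem_range_algebraMap_of_forall_algHom_eq (K := FractionRing A)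
    (AlgebraicClosure (FractionRing B)) (x := algebraMap B (FractionRing B) x) fun σ τ ↦
      DFunLike.congr_fun (algHom_eq_of_injective_comp hinj
        ((σ.restrictScalars A).comp (IsScalarTower.toAlgHom A B (FractionRing B)))
        ((τ.restrictScalars A).comp (IsScalarTower.toAlgHom A B (FractionRing B)))) x
  obtain ⟨b, a, hba, rfl⟩ := IsFractionRing.exists_reduced_fraction A y
  refine ⟨a, b, nonZeroDivisors.coe_ne_zero a, hba, IsFractionRing.injective B (FractionRing B) ?_⟩
  rw [map_mul, ← hy, ← IsScalarTower.algebraMap_apply, ← IsScalarTower.algebraMap_apply,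
    IsScalarTower.algebraMap_apply A (FractionRing A), IsScalarTower.algebraMap_apply A
    (FractionRing A) (FractionRing B) a, ← map_mul, IsLocalization.mk'_spec']

/-- A generically finite dominant morphism to a factorial affine variety in characteristic zero
which is bijective on `k`-points is an isomorphism. -/
theorem algebraMap_surjective_of_bijective_comp [CharZero k] [IsDomain A] [IsDomain B]
    [UniqueFactorizationMonoid A] [FaithfulSMul A B] [Algebra.IsAlgebraic A B]
    [Algebra.FiniteType k A] [Algebra.FiniteType k B]
    (hbij : Function.Bijective fun φ : B →ₐ[k] k ↦ φ.comp (IsScalarTower.toAlgHom k A B)) :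
    Function.Surjective (algebraMap A B) := by
  intro x
  obtain ⟨a, b, ha0, hba, hab⟩ := exists_isRelPrime_of_injective_comp hbij.1 x
  by_cases ha : IsUnit a
  · obtain ⟨u, hu⟩ := ha
    refine ⟨↑u⁻¹ * b, ?_⟩
    rw [map_mul, hab, ← hu, ← mul_assoc, ← map_mul, Units.inv_mul, map_one, one_mul]
  · obtain ⟨p, hp, hpa⟩ := WfDvdMonoid.exists_irreducible_factor ha ha0
    refine absurd (hba ?_ hpa) hp.not_isUnit
    have : (Ideal.span {p}).IsPrime := by
      rw [Ideal.span_singleton_prime hp.ne_zero]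
      exact hp.prime
    rw [← Ideal.mem_span_singleton, ← Ideal.Quotient.eq_zero_iff_mem]
    refine (isNilpotent_of_forall_algHom_apply_eq_zero (k := k) fun ψ ↦ ?_).eq_zero
    obtain ⟨φ, hφ⟩ := hbij.2 (ψ.comp (Ideal.Quotient.mkₐ k (Ideal.span {p})))
    have hφ' (c : A) : φ (algebraMap A B c) = ψ (Ideal.Quotient.mk _ c) :=
      DFunLike.congr_fun hφ c
    rw [← hφ', hab, map_mul, hφ', Ideal.Quotient.eq_zero_iff_mem.mpr
      (Ideal.mem_span_singleton.mpr hpa), map_zero, zero_mul]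

end

/-- The components of an injective polynomial endomorphism of affine space over an algebraically
closed field of characteristic zero generate the coordinate ring. -/
theorem adjoin_range_eq_top_of_injective {k ι : Type*} [Field k] [IsAlgClosed k] [CharZero k]
    [Finite ι] (f : ι → MvPolynomial ι k)
    (hinj : Function.Injective fun v i ↦ eval v (f i)) : Algebra.adjoin k (Set.range f) = ⊤ := by
  have hsurj := ax_grothendieck_univ f hinj
  have hf : AlgebraicIndependent k f := by
    refine (injective_iff_map_eq_zero _).mpr fun a ha ↦ MvPolynomial.funext fun w ↦ ?_
    obtain ⟨v, rfl⟩ := hsurj w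
    have ha' : bind₁ f a = 0 := ha
    simpa [ha'] using (eval₂Hom_bind₁ (RingHom.id k) v f a).symm
  have hbasis : IsTranscendenceBasis k f :=
    hf.isTranscendenceBasis_of_lift_trdeg_le_of_finite
      (by rw [MvPolynomial.trdeg_of_isDomain]; simp)
  have := hbasis.isAlgebraic
  have : Algebra.FiniteType k (Algebra.adjoin k (Set.range f)) :=
    (Subalgebra.fg_iff_finiteType _).mp (Subalgebra.fg_def.mpr ⟨_, Set.finite_range f, rfl⟩)
  have : UniqueFactorizationMonoid (Algebra.adjoin k (Set.range f)) :=
    hf.aevalEquiv.toMulEquiv.uniqueFactorizationMonoid inferInstance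
  have hbij : Function.Bijective fun φ : MvPolynomial ι k →ₐ[k] k ↦
      φ.comp (IsScalarTower.toAlgHom k (Algebra.adjoin k (Set.range f)) (MvPolynomial ι k)) := by
    refine ⟨fun φ φ' h ↦ ?_, fun ψ ↦ ?_⟩
    · have hφ (φ : MvPolynomial ι k →ₐ[k] k) (p) : φ p = eval (φ ∘ X) p := by
        conv_lhs => rw [aeval_unique φ]
        rfl
      ext i
      refine congr_fun (hinj (a₁ := φ ∘ X) (a₂ := φ' ∘ X) (funext fun j ↦ ?_)) i
      simpa [← hφ] using DFunLike.congr_fun h ⟨f j, Algebra.subset_adjoin ⟨j, rfl⟩⟩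
    · obtain ⟨v, hv⟩ := hsurj fun j ↦ ψ ⟨f j, Algebra.subset_adjoin ⟨j, rfl⟩⟩
      refine ⟨aeval v, AlgHom.adjoin_ext ?_⟩
      rintro _ ⟨j, rfl⟩
      simpa [aeval_eq_eval] using congr_fun hv j
  refine Algebra.eq_top_iff.mpr fun b ↦ ?_
  obtain ⟨a, rfl⟩ := algebraMap_surjective_of_bijective_comp hbij b
  exact a.2

theorem stmt_6 (P Q : MvPolynomial (Fin 2) ℂ) (c : ℂ) (hc : c ≠ 0)
    (hjac : jacDet P Q = C c)
    (F : ℂ × ℂ → ℂ × ℂ)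
    (hF : ∀ p : ℂ × ℂ, F p = (eval ![p.1, p.2] P, eval ![p.1, p.2] Q))
    (hinj : Function.Injective F) :
    Function.Bijective F ∧
      ∃ G : ℂ × ℂ → ℂ × ℂ, IsPolyMap G ∧ G ∘ F = id ∧ F ∘ G = id := by
  have hv (v : Fin 2 → ℂ) : ![v 0, v 1] = v := by ext i; fin_cases i <;> rfl
  have hinj' : Function.Injective fun v i ↦ eval v (![P, Q] i) := fun v w h ↦ by
    have := @hinj (v 0, v 1) (w 0, w 1) (by
      simpa [hF, hv] using And.intro (congr_fun h 0) (congr_fun h 1))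
    rw [Prod.mk.injEq] at this
    rw [← hv v, ← hv w, this.1, this.2]
  have hX (i : Fin 2) : ∃ R : MvPolynomial (Fin 2) ℂ,
      (aeval ![P, Q] R : MvPolynomial (Fin 2) ℂ) = X i := by
    rw [← AlgHom.mem_range, ← Algebra.adjoin_range_eq_range_aeval,
      adjoin_range_eq_top_of_injective _ hinj']
    exact Algebra.mem_top
  choose R hR using hX
  have heval (p : ℂ × ℂ) (i : Fin 2) : eval ![(F p).1, (F p).2] (R i) = ![p.1, p.2] i := by
    have h : (aeval ![P, Q] : MvPolynomial (Fin 2) ℂ →ₐ[ℂ] MvPolynomial (Fin 2) ℂ) =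
        bind₁ ![P, Q] := rfl
    have := congrArg (eval ![p.1, p.2]) (hR i)
    rw [h, eval_X, eval, eval₂Hom_bind₁] at this
    rw [← this, eval]
    congr 2
    ext j
    fin_cases j <;> simp [hF]
  have hGF (p : ℂ × ℂ) : (eval ![(F p).1, (F p).2] (R 0), eval ![(F p).1, (F p).2] (R 1)) = p :=
    Prod.ext (heval p 0) (heval p 1)
  have hsurj : Function.Surjective F := fun q ↦ by
    obtain ⟨v, h⟩ := ax_grothendieck_univ _ hinj' ![q.1, q.2]
    exact ⟨(v 0, v 1), by
      simpa [hF, hv] using Prod.ext (congr_fun h 0) (congr_fun h 1)⟩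
  refine ⟨⟨hinj, hsurj⟩, _, ⟨R 0, R 1, fun _ ↦ rfl⟩, funext hGF, funext fun q ↦ ?_⟩
  obtain ⟨p, rfl⟩ := hsurj q
  exact congrArg F (hGF p)
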